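/- For an n-form ω on a 2n-dimensional symplectic vector space (V, Ω), the condition i_{X_Ω}(ω) = 0 is equivalent to ω ∧ Ω = 0. -/

import Mathlib

/- Framework: exterior forms on a real vector space `V` are modelled as elements of the
exterior algebra of the dual space; a `k`-form is an element of the submodule
`⋀[ℝ]^k (Module.Dual ℝ V)`, and the wedge product is the algebra multiplication. -/

noncomputable section
open ExteriorAlgebra
set_option synthInstance.maxHeartbeats 1000000
set_option maxHeartbeats 1000000

variable (V : Type) [AddCommGroup V] [Module ℝ V]

/-- The algebra of exterior forms on `V`. -/
abbrev EForm := ExteriorAlgebra ℝ (Module.Dual ℝ V)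

variable {V}

/-- Interior product (contraction) of forms by a vector, linear in the vector. -/
def iContrL : V →ₗ[ℝ] Module.End ℝ (EForm V) :=
  (CliffordAlgebra.contractLeft (Q := (0 : QuadraticForm ℝ (Module.Dual ℝ V)))).comp
    (Module.Dual.eval ℝ V)

/-- Contraction of forms by an arbitrary element of the exterior algebra of `V`
(e.g. by a bivector), extending `iContrL` as an algebra morphism. -/
def aContr : ExteriorAlgebra ℝ V →ₐ[ℝ] Module.End ℝ (EForm V) :=
  ExteriorAlgebra.lift ℝ ⟨iContrL, fun _ =>
    LinearMap.ext fun _ => CliffordAlgebra.contractLeft_contractLeft _ _⟩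

/-- The bilinear form on `V` associated with an exterior 2-form, via double contraction
(the scalar part is extracted by `ExteriorAlgebra.algebraMapInv`). -/
def formToBilin (Om : EForm V) : V →ₗ[ℝ] V →ₗ[ℝ] ℝ :=
  LinearMap.mk₂ ℝ (fun x y => algebraMapInv (iContrL y (iContrL x Om)))
    (fun x x' y => by simp [map_add, LinearMap.add_apply])
    (fun c x y => by simp [map_smul, LinearMap.smul_apply])
    (fun x y y' => by simp [map_add, LinearMap.add_apply])
    (fun c x y => by simp [map_smul, LinearMap.smul_apply])

/-- A 2-form is nondegenerate (symplectic) if its associated bilinear form is. -/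
def IsSymplecticForm (Om : EForm V) : Prop :=
  Om ∈ ⋀[ℝ]^2 (Module.Dual ℝ V) ∧ ∀ x : V, (∀ y : V, formToBilin Om x y = 0) → x = 0

/-- The algebra morphism `⋀ V → ⋀ V*` induced by a linear map `Γ : V → V*`. -/
def extAlgMap (f : V →ₗ[ℝ] Module.Dual ℝ V) : ExteriorAlgebra ℝ V →ₐ[ℝ] EForm V :=
  ExteriorAlgebra.lift ℝ ⟨(ExteriorAlgebra.ι ℝ).comp f, fun _ => ι_sq_zero _⟩

/-- `XOm` is the bivector dual to the symplectic form `Om`, i.e. the unique bivector with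
`Γ^*(X_Ω) = Ω` where `Γ : V → V*` is the isomorphism induced by `Om`. -/
def IsDualBivector (Om : EForm V) (XOm : ExteriorAlgebra ℝ V) : Prop :=
  XOm ∈ ⋀[ℝ]^2 V ∧ extAlgMap (formToBilin Om) XOm = Om

/-- The pullback action on forms induced by an endomorphism `K : V → V`. -/
def formPullback (K : V →ₗ[ℝ] V) : EForm V →ₐ[ℝ] EForm V :=
  ExteriorAlgebra.lift ℝ ⟨(ExteriorAlgebra.ι ℝ).comp K.dualMap, fun _ => ι_sq_zero _⟩


attribute [local instance] LieRing.ofAssociativeRing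

theorem lie_mul_of_ring {A : Type*} [Ring A] (a b c : A) : ⁅a, b * c⁆ = ⁅a, b⁆ * c + b * ⁅a, c⁆ := by
  simp only [Ring.lie_def]
  noncomm_ring

/-- A weight vector condition on the generators propagates to all homogeneous elements. -/
theorem lie_algHom_of_mem_exteriorPower {M A : Type*} [AddCommGroup M] [Module ℝ M] [Ring A]
    [Algebra ℝ A] (F : ExteriorAlgebra ℝ M →ₐ[ℝ] A) (H : A) (c : ℝ)
    (h : ∀ m, ⁅H, F (ι ℝ m)⁆ = c • F (ι ℝ m)) {k : ℕ} {x : ExteriorAlgebra ℝ M}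
    (hx : x ∈ ⋀[ℝ]^k M) : ⁅H, F x⁆ = (k * c) • F x := by
  induction hx using Submodule.pow_induction_on_left' with
  | algebraMap r => simp [Ring.lie_def, Algebra.commutes]
  | add x y i _ _ hx hy => rw [map_add, lie_add, hx, hy, smul_add]
  | mem_mul m hm i x _ hx =>
    obtain ⟨m, rfl⟩ := hm
    rw [map_mul, lie_mul_of_ring, h, hx, smul_mul_assoc, mul_smul_comm, ← add_smul]
    congr 1
    push_cast
    ring

@[elab_as_elim]
theorem exteriorPower_two_induction {M : Type*} [AddCommGroup M] [Module ℝ M]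
    {C : ExteriorAlgebra ℝ M → Prop} (mul : ∀ a b, C (ι ℝ a * ι ℝ b))
    (add : ∀ x y, C x → C y → C (x + y)) {x : ExteriorAlgebra ℝ M} (hx : x ∈ ⋀[ℝ]^2 M) : C x := by
  rw [exteriorPower, pow_two] at hx
  refine Submodule.mul_induction_on hx ?_ add
  rintro _ ⟨a, rfl⟩ _ ⟨b, rfl⟩
  exact mul a b

theorem commute_of_mem_exteriorPower_two {M : Type*} [AddCommGroup M] [Module ℝ M]
    {x : ExteriorAlgebra ℝ M} (hx : x ∈ ⋀[ℝ]^2 M) (y : ExteriorAlgebra ℝ M) : Commute x y := by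
  induction y using ExteriorAlgebra.induction with
  | algebraMap r => exact (Algebra.commutes r x).symm
  | mul a b ha hb => exact ha.mul_right hb
  | add a b ha hb => exact ha.add_right hb
  | ι m =>
    refine exteriorPower_two_induction (fun a b => ?_) (fun x y hx hy => ?_) hx
    · have h (u : M) : ι ℝ u * ι ℝ m = -(ι ℝ m * ι ℝ u) :=
        eq_neg_of_add_eq_zero_left (ι_add_mul_swap u m)
      rw [Commute, SemiconjBy, mul_assoc, h b, mul_neg, ← mul_assoc, h a, neg_mul, neg_neg,
        mul_assoc]
    · exact hx.add_left hy

theorem contractLeft_ι_mul_ι {M : Type*} [AddCommGroup M] [Module ℝ M] (d : Module.Dual ℝ M)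
    (a b : M) : CliffordAlgebra.contractLeft (Q := (0 : QuadraticForm ℝ M)) d (ι ℝ a * ι ℝ b) =
      ι ℝ (d a • b - d b • a) := by
  rw [ι, CliffordAlgebra.contractLeft_ι_mul, CliffordAlgebra.contractLeft_ι,
    ← Algebra.commutes, ← Algebra.smul_def, map_sub, map_smul, map_smul]

theorem exists_contractLeft_eq_ι {M : Type*} [AddCommGroup M] [Module ℝ M] (d : Module.Dual ℝ M)
    {x : ExteriorAlgebra ℝ M} (hx : x ∈ ⋀[ℝ]^2 M) :
    ∃ m, CliffordAlgebra.contractLeft (Q := (0 : QuadraticForm ℝ M)) d x = ι ℝ m := by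
  refine exteriorPower_two_induction (fun a b => ?_) (fun x y hx hy => ?_) hx
  · exact ⟨_, contractLeft_ι_mul_ι d a b⟩
  · obtain ⟨u, hu⟩ := hx
    obtain ⟨w, hw⟩ := hy
    exact ⟨u + w, by rw [map_add, hu, hw, map_add]⟩

theorem iContrL_ι_mul (v : V) (φ : Module.Dual ℝ V) (x : EForm V) :
    iContrL v (ι ℝ φ * x) = φ v • x - ι ℝ φ * iContrL v x :=
  CliffordAlgebra.contractLeft_ι_mul _ φ x

theorem iContrL_ι (v : V) (φ : Module.Dual ℝ V) :
    iContrL v (ι ℝ φ) = algebraMap ℝ _ (φ v) :=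
  CliffordAlgebra.contractLeft_ι (0 : QuadraticForm ℝ (Module.Dual ℝ V)) _ φ

theorem iContrL_one (v : V) : iContrL v (1 : EForm V) = 0 :=
  CliffordAlgebra.contractLeft_one (0 : QuadraticForm ℝ (Module.Dual ℝ V)) _

theorem iContrL_iContrL (v : V) (x : EForm V) : iContrL v (iContrL v x) = 0 :=
  CliffordAlgebra.contractLeft_contractLeft _ x

theorem aContr_ι (v : V) : aContr (ι ℝ v) = iContrL v :=
  ExteriorAlgebra.lift_ι_apply _ _ _ _

theorem extAlgMap_ι (f : V →ₗ[ℝ] Module.Dual ℝ V) (v : V) :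
    extAlgMap f (ι ℝ v) = ι ℝ (f v) :=
  ExteriorAlgebra.lift_ι_apply _ _ _ _

theorem lie_iContrL_lmul (v : V) {x : EForm V} (hx : x ∈ ⋀[ℝ]^2 (Module.Dual ℝ V)) :
    ⁅iContrL v, Algebra.lmul ℝ (EForm V) x⁆ = Algebra.lmul ℝ (EForm V) (iContrL v x) := by
  refine exteriorPower_two_induction (fun a b => ?_) (fun x y hx hy => ?_) hx
  · refine LinearMap.ext fun y => ?_
    simp only [Ring.lie_def, LinearMap.sub_apply, Module.End.mul_apply, Algebra.coe_lmul_eq_mul,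
      LinearMap.mul_apply', mul_assoc, iContrL_ι_mul, iContrL_ι, ← Algebra.commutes,
      ← Algebra.smul_def, sub_mul, mul_sub, smul_mul_assoc, mul_smul_comm]
    abel
  · rw [map_add, lie_add, hx, hy, map_add, map_add]

theorem lie_aContr_lmul_ι {X : ExteriorAlgebra ℝ V} (hX : X ∈ ⋀[ℝ]^2 V) (φ : Module.Dual ℝ V) :
    ⁅aContr X, Algebra.lmul ℝ (EForm V) (ι ℝ φ)⁆ =
      -aContr (CliffordAlgebra.contractLeft (Q := (0 : QuadraticForm ℝ V)) φ X) := by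
  refine exteriorPower_two_induction (fun a b => ?_) (fun x y hx hy => ?_) hX
  · refine LinearMap.ext fun y => ?_
    simp only [contractLeft_ι_mul_ι, aContr_ι, map_mul, Ring.lie_def, LinearMap.sub_apply,
      Module.End.mul_apply, Algebra.coe_lmul_eq_mul, LinearMap.mul_apply', iContrL_ι_mul, map_sub,
      map_smul, LinearMap.neg_apply, LinearMap.smul_apply]
    abel
  · rw [map_add, add_lie, hx, hy, map_add, map_add, neg_add]

theorem lie_aContr_iContrL {X : ExteriorAlgebra ℝ V} (hX : X ∈ ⋀[ℝ]^2 V) (v : V) :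
    ⁅aContr X, iContrL v⁆ = 0 := by
  rw [← aContr_ι, ← commute_iff_lie_eq]
  exact (commute_of_mem_exteriorPower_two hX _).map aContr

theorem iContrL_eq_ι_formToBilin {Om : EForm V} (hOm : Om ∈ ⋀[ℝ]^2 (Module.Dual ℝ V)) (v : V) :
    iContrL v Om = ι ℝ (formToBilin Om v) := by
  obtain ⟨ψ, hψ⟩ := exists_contractLeft_eq_ι (Module.Dual.eval ℝ V v) hOm
  have hψ' : iContrL v Om = ι ℝ ψ := hψ
  rw [hψ']
  congr 1
  ext y
  change _ = algebraMapInv (iContrL y (iContrL v Om))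
  rw [hψ', iContrL_ι, algebraMap_leftInverse]

theorem formToBilin_swap (Om : EForm V) (u v : V) :
    formToBilin Om u v = -formToBilin Om v u := by
  have h : iContrL v (iContrL u Om) = -iContrL u (iContrL v Om) :=
    CliffordAlgebra.contractLeft_comm _ _ _
  change algebraMapInv (iContrL v (iContrL u Om)) = -algebraMapInv (iContrL u (iContrL v Om))
  rw [h, map_neg]

/-- Contraction intertwines with the induced morphism `⋀ V → ⋀ V*` of a skew map. -/
theorem iContrL_extAlgMap {f : V →ₗ[ℝ] Module.Dual ℝ V} (hf : ∀ u v, f u v = -f v u) (v : V)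
    {X : ExteriorAlgebra ℝ V} (hX : X ∈ ⋀[ℝ]^2 V) :
    iContrL v (extAlgMap f X) =
      -extAlgMap f (CliffordAlgebra.contractLeft (Q := (0 : QuadraticForm ℝ V)) (f v) X) := by
  refine exteriorPower_two_induction (fun a b => ?_) (fun x y hx hy => ?_) hX
  · simp only [contractLeft_ι_mul_ι, extAlgMap_ι, map_mul, iContrL_ι_mul, iContrL_ι, map_sub,
      map_smul, ← Algebra.commutes, ← Algebra.smul_def, hf a v, hf b v]
    module
  · simp only [map_add, hx, hy, neg_add]

section Symplectic

variable {Om : EForm V} {XOm : ExteriorAlgebra ℝ V}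

theorem IsSymplecticForm.injective (hOm : IsSymplecticForm Om) :
    Function.Injective (formToBilin Om) := by
  rw [injective_iff_map_eq_zero]
  intro x hx
  exact hOm.2 x fun y => by rw [hx, LinearMap.zero_apply]

theorem IsSymplecticForm.surjective [FiniteDimensional ℝ V] (hOm : IsSymplecticForm Om) :
    Function.Surjective (formToBilin Om) :=
  (LinearMap.injective_iff_surjective_of_finrank_eq_finrank
    Subspace.dual_finrank_eq.symm).1 hOm.injective

theorem contractLeft_dualBivector (hOm : IsSymplecticForm Om) (hX : IsDualBivector Om XOm)
    (v : V) : CliffordAlgebra.contractLeft (Q := (0 : QuadraticForm ℝ V))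
      (formToBilin Om v) XOm = -ι ℝ v := by
  obtain ⟨u, hu⟩ := exists_contractLeft_eq_ι (formToBilin Om v) hX.1
  have h := iContrL_extAlgMap (formToBilin_swap Om) v hX.1
  rw [hX.2, hu, extAlgMap_ι, iContrL_eq_ι_formToBilin hOm.1, ← map_neg, ι_inj, ← map_neg] at h
  rw [hu, hOm.injective h, map_neg, neg_neg]

theorem lie_aContr_dualBivector_lmul_ι (hOm : IsSymplecticForm Om) (hX : IsDualBivector Om XOm)
    (v : V) :
    ⁅aContr XOm, Algebra.lmul ℝ (EForm V) (ι ℝ (formToBilin Om v))⁆ = iContrL v := by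
  rw [lie_aContr_lmul_ι hX.1, contractLeft_dualBivector hOm hX, map_neg, aContr_ι, neg_neg]

/-- The commutator of the Lefschetz operator and its dual. -/
def lefschetzCommutator (Om : EForm V) (XOm : ExteriorAlgebra ℝ V) : Module.End ℝ (EForm V) :=
  ⁅aContr XOm, Algebra.lmul ℝ (EForm V) Om⁆

theorem lie_lefschetzCommutator_iContrL (hOm : IsSymplecticForm Om)
    (hX : IsDualBivector Om XOm) (v : V) :
    ⁅lefschetzCommutator Om XOm, iContrL v⁆ = -iContrL v := by
  rw [lefschetzCommutator, lie_lie, lie_aContr_iContrL hX.1, lie_zero, sub_zero,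
    ← lie_skew _ (iContrL v), lie_iContrL_lmul v hOm.1, iContrL_eq_ι_formToBilin hOm.1, lie_neg,
    lie_aContr_dualBivector_lmul_ι hOm hX]

theorem lie_lefschetzCommutator_lmul_ι [FiniteDimensional ℝ V] (hOm : IsSymplecticForm Om)
    (hX : IsDualBivector Om XOm) (φ : Module.Dual ℝ V) :
    ⁅lefschetzCommutator Om XOm, Algebra.lmul ℝ (EForm V) (ι ℝ φ)⁆ =
      Algebra.lmul ℝ (EForm V) (ι ℝ φ) := by
  obtain ⟨v, rfl⟩ := hOm.surjective φ
  have h : ⁅Algebra.lmul ℝ (EForm V) Om, Algebra.lmul ℝ (EForm V) (ι ℝ (formToBilin Om v))⁆ = 0 :=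
    commute_iff_lie_eq.1 ((commute_of_mem_exteriorPower_two hOm.1 _).map _)
  rw [lefschetzCommutator, lie_lie, h, lie_zero, lie_aContr_dualBivector_lmul_ι hOm hX,
    ← lie_skew, lie_iContrL_lmul v hOm.1, iContrL_eq_ι_formToBilin hOm.1, zero_sub, neg_neg]

/-- Euler's identity for 2-forms. -/
theorem sum_coord_mul_iContrL {κ : Type*} [Fintype κ] (b : Module.Basis κ ℝ V) {x : EForm V}
    (hx : x ∈ ⋀[ℝ]^2 (Module.Dual ℝ V)) :
    ∑ i, ι ℝ (b.coord i) * iContrL (b i) x = (2 : ℝ) • x := by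
  have hsum (φ : Module.Dual ℝ V) : ∑ i, φ (b i) • b.coord i = φ :=
    b.ext fun j => by simp
  refine exteriorPower_two_induction (fun φ ψ => ?_) (fun x y hx hy => ?_) hx
  · have h (i : κ) : ι ℝ (b.coord i) * iContrL (b i) (ι ℝ φ * ι ℝ ψ) =
        ι ℝ (φ (b i) • b.coord i) * ι ℝ ψ - ι ℝ (ψ (b i) • b.coord i) * ι ℝ φ := by
      rw [iContrL_ι_mul, iContrL_ι, ← Algebra.commutes, ← Algebra.smul_def]
      simp only [mul_sub, map_smul, smul_mul_assoc, mul_smul_comm]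
    simp only [h, Finset.sum_sub_distrib, ← Finset.sum_mul, ← map_sum, hsum]
    rw [eq_neg_of_add_eq_zero_right (ι_add_mul_swap φ ψ), sub_neg_eq_add, two_smul]
  · simp only [map_add, mul_add, Finset.sum_add_distrib, hx, hy, smul_add]

theorem aContr_one_of_mem_exteriorPower_two {X : ExteriorAlgebra ℝ V} (hX : X ∈ ⋀[ℝ]^2 V) :
    aContr X (1 : EForm V) = 0 := by
  refine exteriorPower_two_induction (fun a b => ?_) (fun x y hx hy => ?_) hX
  · rw [map_mul, Module.End.mul_apply, aContr_ι, aContr_ι, iContrL_one, map_zero]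
  · rw [map_add, LinearMap.add_apply, hx, hy, add_zero]

theorem aContr_dualBivector_ι_mul (hOm : IsSymplecticForm Om) (hX : IsDualBivector Om XOm)
    (v : V) (x : EForm V) : aContr XOm (ι ℝ (formToBilin Om v) * x) =
      iContrL v x + ι ℝ (formToBilin Om v) * aContr XOm x := by
  have h := LinearMap.congr_fun (lie_aContr_dualBivector_lmul_ι hOm hX v) x
  rw [← h]
  simp [Ring.lie_def]

theorem aContr_dualBivector_symplecticForm [FiniteDimensional ℝ V] (hOm : IsSymplecticForm Om)
    (hX : IsDualBivector Om XOm) :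
    (2 : ℝ) • aContr XOm Om = algebraMap ℝ _ (-(Module.finrank ℝ V : ℝ)) := by
  have h1 (ψ : Module.Dual ℝ V) : aContr XOm (ι ℝ ψ) = 0 := by
    obtain ⟨v, rfl⟩ := hOm.surjective ψ
    rw [← mul_one (ι ℝ _), aContr_dualBivector_ι_mul hOm hX, iContrL_one,
      aContr_one_of_mem_exteriorPower_two hX.1, mul_zero, add_zero]
  have h2 (i) : aContr XOm (ι ℝ ((Module.finBasis ℝ V).coord i) *
      iContrL (Module.finBasis ℝ V i) Om) = algebraMap ℝ _ (-1) := by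
    obtain ⟨v, hv⟩ := hOm.surjective ((Module.finBasis ℝ V).coord i)
    rw [← hv, aContr_dualBivector_ι_mul hOm hX, iContrL_eq_ι_formToBilin hOm.1, h1, mul_zero,
      add_zero, iContrL_ι, formToBilin_swap, hv]
    simp
  rw [← map_smul, ← sum_coord_mul_iContrL (Module.finBasis ℝ V) hOm.1, map_sum]
  simp [h2]

theorem lefschetzCommutator_apply [FiniteDimensional ℝ V] (hOm : IsSymplecticForm Om)
    (hX : IsDualBivector Om XOm) {k : ℕ} {x : EForm V} (hx : x ∈ ⋀[ℝ]^k (Module.Dual ℝ V)) :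
    lefschetzCommutator Om XOm x = (k - Module.finrank ℝ V / 2 : ℝ) • x := by
  have h1 : lefschetzCommutator Om XOm 1 = (-(Module.finrank ℝ V / 2) : ℝ) • (1 : EForm V) := by
    have h : lefschetzCommutator Om XOm 1 = aContr XOm Om := by
      simp [lefschetzCommutator, Ring.lie_def, aContr_one_of_mem_exteriorPower_two hX.1]
    have h2 := aContr_dualBivector_symplecticForm hOm hX
    rw [h, ← inv_smul_smul₀ (two_ne_zero (α := ℝ)) (aContr XOm Om), h2,
      Algebra.algebraMap_eq_smul_one, smul_smul]
    congr 1
    ring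
  have h := LinearMap.congr_fun (lie_algHom_of_mem_exteriorPower (Algebra.lmul ℝ (EForm V))
    (lefschetzCommutator Om XOm) 1
    (fun φ => by rw [one_smul, lie_lefschetzCommutator_lmul_ι hOm hX]) hx) 1
  simp only [Ring.lie_def, LinearMap.sub_apply, Module.End.mul_apply, Algebra.coe_lmul_eq_mul,
    LinearMap.mul_apply', mul_one, LinearMap.smul_apply, h1, mul_smul_comm] at h
  rw [sub_eq_iff_eq_add.1 h]
  module

theorem isSl2Triple_lefschetz [FiniteDimensional ℝ V] (hOm : IsSymplecticForm Om)
    (hX : IsDualBivector Om XOm) (h0 : lefschetzCommutator Om XOm ≠ 0) :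
    IsSl2Triple (lefschetzCommutator Om XOm) (Algebra.lmul ℝ (EForm V) Om) (-aContr XOm) where
  h_ne_zero := h0
  lie_e_f := by rw [lie_neg, lie_skew, lefschetzCommutator]
  lie_h_e_nsmul := by
    rw [lie_algHom_of_mem_exteriorPower (Algebra.lmul ℝ (EForm V)) _ 1
      (fun φ => by rw [one_smul, lie_lefschetzCommutator_lmul_ι hOm hX]) hOm.1, mul_one,
      Nat.cast_smul_eq_nsmul]
  lie_h_f_nsmul := by
    rw [lie_neg, lie_algHom_of_mem_exteriorPower aContr _ (-1)
      (fun v => by rw [aContr_ι, lie_lefschetzCommutator_iContrL hOm hX, neg_one_smul]) hX.1,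
      mul_neg_one, neg_smul, Nat.cast_smul_eq_nsmul, smul_neg]

end Symplectic

/-- In a finite-dimensional representation, a vector of weight zero killed by one nilpotent
element of an `sl₂` triple is killed by the other. -/
theorem IsSl2Triple.lie_f_eq_zero_of_weight_zero {L M : Type*} [LieRing L] [LieAlgebra ℝ L]
    [AddCommGroup M] [Module ℝ M] [FiniteDimensional ℝ M] [LieRingModule L M] [LieModule ℝ L M]
    {h e f : L} (t : IsSl2Triple h e f) {m : M} (hm : ⁅h, m⁆ = 0) (he : ⁅e, m⁆ = 0) :
    ⁅f, m⁆ = 0 := by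
  by_cases h0 : m = 0
  · rw [h0, lie_zero]
  have P : t.HasPrimitiveVectorWith m (0 : ℝ) := ⟨h0, by rw [hm, zero_smul], he⟩
  simpa using P.pow_toEnd_f_eq_zero_of_eq_nat (n := 0) Nat.cast_zero.symm

/-- For an `n`-form `ω` on a `2n`-dimensional symplectic vector space `(V, Ω)`,
`i_{X_Ω}(ω) = 0` if and only if `ω ∧ Ω = 0`. -/
theorem effective_iff_contraction_zero [FiniteDimensional ℝ V] (n : ℕ)
    (hdim : Module.finrank ℝ V = 2 * n)
    (Om : EForm V) (hOm : IsSymplecticForm Om)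
    (XOm : ExteriorAlgebra ℝ V) (hX : IsDualBivector Om XOm)
    (ω : EForm V) (hω : ω ∈ ⋀[ℝ]^n (Module.Dual ℝ V)) :
    aContr XOm ω = 0 ↔ ω * Om = 0 := by
  have hcomm : ω * Om = Algebra.lmul ℝ (EForm V) Om ω :=
    (commute_of_mem_exteriorPower_two hOm.1 ω).eq.symm
  rw [hcomm]
  by_cases h0 : lefschetzCommutator Om XOm = 0
  · have hL := lie_algHom_of_mem_exteriorPower (Algebra.lmul ℝ (EForm V)) _ 1
      (fun φ => by rw [one_smul, lie_lefschetzCommutator_lmul_ι hOm hX]) hOm.1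
    have hΛ := lie_algHom_of_mem_exteriorPower aContr _ (-1)
      (fun v => by rw [aContr_ι, lie_lefschetzCommutator_iContrL hOm hX, neg_one_smul]) hX.1
    rw [h0, zero_lie, eq_comm, smul_eq_zero] at hL hΛ
    rw [hL.resolve_left (by norm_num), hΛ.resolve_left (by norm_num)]
  have : FiniteDimensional ℝ (EForm V) :=
    (Module.finBasis ℝ (Module.Dual ℝ V)).ExteriorAlgebra.finiteDimensional_of_finite
  have t := isSl2Triple_lefschetz hOm hX h0
  have hH : lefschetzCommutator Om XOm ω = 0 := by
    rw [lefschetzCommutator_apply hOm hX hω, hdim]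
    simp
  constructor
  · intro h
    exact t.symm.lie_f_eq_zero_of_weight_zero (m := ω) (by simpa using hH) (by simpa using h)
  · intro h
    have := t.lie_f_eq_zero_of_weight_zero (m := ω) hH h
    simpa using this
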